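/- arXiv:2411.12840 — 2 statements merged into one kernel-verified Lean document; each statement's English description precedes it below -/
import Mathlib

section
/- Permutation covariance implies shift covariance: let A, X, Y be standard Borel spaces, let p : A → (ℕ → X) be an exchangeable Markov kernel, and let f : (ℕ → X) → (ℕ → Y) be a Markov kernel such that for every permutation σ of ℕ fixing all but finitely many elements and every a ∈ A, for p(a)-almost every x, f(x ∘ σ) equals the pushforward of f(x) under y ↦ y ∘ σ. Then for every a ∈ A, for p(a)-almost every x, f(x ∘ succ) equals the pushforward of f(x) under y ↦ y ∘ succ, where z ∘ succ denotes the shifted sequence (z_{k+1})_{k∈ℕ}. -/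
open MeasureTheory ProbabilityTheory

/-- A Markov kernel `p : A → (ℕ → X)` is exchangeable if for every permutation `σ` of `ℕ`
fixing all but finitely many elements and every `a`, the pushforward of `p a` under
`x ↦ x ∘ σ` equals `p a`. -/
def ExchangeableKernel {A X : Type*} [MeasurableSpace A] [MeasurableSpace X]
    (p : Kernel A (ℕ → X)) : Prop :=
  ∀ σ : Equiv.Perm ℕ, {n | σ n ≠ n}.Finite → ∀ a, (p a).map (fun x => x ∘ σ) = p a

/-- Finite permutations agree with the shift `k ↦ k + 1` on arbitrarily long initial segments. -/
lemma exists_finite_perm_eq_succ (n : ℕ) :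
    ∃ σ : Equiv.Perm ℕ, {k | σ k ≠ k}.Finite ∧ ∀ k < n, σ k = k + 1 := by
  suffices ∃ σ : Equiv.Perm ℕ, (∀ k, n < k → σ k = k) ∧ ∀ k < n, σ k = k + 1 by
    obtain ⟨σ, hfix, hσ⟩ := this
    refine ⟨σ, (Set.finite_Iic n).subset fun k hk ↦ ?_, hσ⟩
    by_contra hnk
    exact hk (hfix k (not_le.mp hnk))
  induction n with
  | zero => exact ⟨1, by simp, by simp⟩
  | succ n ih =>
    obtain ⟨σ, hfix, hσ⟩ := ih
    refine ⟨σ * Equiv.swap n (n + 1), fun k hk ↦ ?_, fun k hk ↦ ?_⟩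
    · rw [Equiv.Perm.mul_apply, Equiv.swap_apply_of_ne_of_ne (by omega) (by omega)]
      exact hfix k (by omega)
    · rcases Nat.lt_succ_iff_lt_or_eq.mp hk with hk | rfl
      · rw [Equiv.Perm.mul_apply, Equiv.swap_apply_of_ne_of_ne (by omega) (by omega)]
        exact hσ k hk
      · simpa using hfix (k + 1) (by omega)

lemma measurable_comp_reindex {ι κ X : Type*} [MeasurableSpace X] (τ : κ → ι) :
    Measurable (fun x : ι → X ↦ x ∘ τ) :=
  measurable_pi_lambda _ fun k ↦ measurable_pi_apply (τ k)

lemma Finset.restrict_comp_reindex_congr {X : Type*} {I : Finset ℕ} {n : ℕ}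
    (hI : ∀ k ∈ I, k < n) {σ τ : ℕ → ℕ} (h : ∀ k < n, σ k = τ k) (x : ℕ → X) :
    I.restrict (x ∘ σ) = I.restrict (x ∘ τ) := by
  ext ⟨k, hk⟩
  simp [h k (hI k hk)]

/-- A finite measure invariant under reindexings that agree with `τ` on arbitrarily long initial
segments is invariant under reindexing by `τ`. -/
lemma measurePreserving_comp_reindex {X : Type*} [MeasurableSpace X] {μ : Measure (ℕ → X)}
    [IsFiniteMeasure μ] {τ : ℕ → ℕ}
    (h : ∀ n, ∃ σ : ℕ → ℕ, MeasurePreserving (fun x : ℕ → X ↦ x ∘ σ) μ μ ∧ ∀ k < n, σ k = τ k) :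
    MeasurePreserving (fun x : ℕ → X ↦ x ∘ τ) μ μ := by
  refine ⟨measurable_comp_reindex τ, ?_⟩
  refine IsProjectiveLimit.unique (P := fun I ↦ μ.map I.restrict) (fun I ↦ ?_) fun I ↦ rfl
  obtain ⟨n, hn⟩ := I.exists_nat_subset_range
  obtain ⟨σ, hσ, hστ⟩ := h n
  rw [Measure.map_map (Finset.measurable_restrict I) (measurable_comp_reindex τ)]
  conv_rhs => change μ.map I.restrict; rw [← hσ.map_eq]
  rw [Measure.map_map (Finset.measurable_restrict I) hσ.measurable]
  congr 1
  ext1 x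
  exact (Finset.restrict_comp_reindex_congr (fun k hk ↦ Finset.mem_range.mp (hn hk)) hστ x).symm

lemma iSup_piLE_nat (X : Type*) [MeasurableSpace X] :
    ⨆ n, (Filtration.piLE (X := fun _ : ℕ ↦ X)) n = MeasurableSpace.pi := by
  refine le_antisymm (iSup_le fun n ↦ Filtration.le _ n) (iSup_le fun n ↦ ?_)
  refine le_iSup_of_le n ?_
  rintro _ ⟨t, ht, rfl⟩
  exact ⟨(fun x : Set.Iic n → X ↦ x ⟨n, Set.self_mem_Iic⟩) ⁻¹' t,
    measurable_pi_apply (⟨n, Set.self_mem_Iic⟩ : Set.Iic n) ht, rfl⟩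

/-- Integrable functions of a sequence are approximated in `L¹` by functions of finitely many
coordinates. -/
lemma exists_dependsOn_eLpNorm_sub_lt {X : Type*} [MeasurableSpace X] {μ : Measure (ℕ → X)}
    [IsFiniteMeasure μ] {F : (ℕ → X) → ℝ} (hF : Integrable F μ) (hFm : Measurable F)
    {ε : ENNReal} (hε : 0 < ε) :
    ∃ (G : (ℕ → X) → ℝ) (n : ℕ), Measurable G ∧ DependsOn G (Set.Iic n) ∧
      eLpNorm (G - F) 1 μ < ε := by
  have hlim := hF.tendsto_eLpNorm_condExp (ℱ := Filtration.piLE (X := fun _ : ℕ ↦ X))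
    (by rw [iSup_piLE_nat]; exact hFm.stronglyMeasurable)
  obtain ⟨n, hn⟩ := (hlim.eventually_lt_const hε).exists
  exact ⟨_, n, (stronglyMeasurable_condExp.mono (Filtration.le _ n)).measurable,
    stronglyMeasurable_condExp.dependsOn_of_piLE, hn⟩

/-- If `F (x ∘ σ) = H x` almost surely for measure-preserving reindexings `σ` agreeing with `τ` on
arbitrarily long initial segments, then `F (x ∘ τ) = H x` almost surely. -/
lemma ae_eq_comp_reindex {X : Type*} [MeasurableSpace X] {μ : Measure (ℕ → X)}
    [IsFiniteMeasure μ] {τ : ℕ → ℕ} {F H : (ℕ → X) → ℝ} (hF : Integrable F μ) (hFm : Measurable F)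
    (h : ∀ n, ∃ σ : ℕ → ℕ, MeasurePreserving (fun x : ℕ → X ↦ x ∘ σ) μ μ ∧
      (∀ k < n, σ k = τ k) ∧ ∀ᵐ x ∂μ, F (x ∘ σ) = H x) :
    ∀ᵐ x ∂μ, F (x ∘ τ) = H x := by
  have hτ : MeasurePreserving (fun x : ℕ → X ↦ x ∘ τ) μ μ :=
    measurePreserving_comp_reindex fun n ↦ (h n).imp fun σ hσ ↦ ⟨hσ.1, hσ.2.1⟩
  obtain ⟨σ₀, hσ₀, -, hH₀⟩ := h 0
  have hHm : AEStronglyMeasurable H μ :=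
    (hF.1.comp_measurePreserving hσ₀).congr hH₀
  have hFτm : AEStronglyMeasurable (fun x ↦ F (x ∘ τ)) μ := hF.1.comp_measurePreserving hτ
  suffices eLpNorm ((fun x ↦ F (x ∘ τ)) - H) 1 μ = 0 by
    rw [eLpNorm_eq_zero_iff (hFτm.sub hHm) one_ne_zero] at this
    filter_upwards [this] with x hx using sub_eq_zero.mp hx
  refine le_antisymm (ENNReal.le_of_forall_pos_le_add fun ε hε _ ↦ ?_) zero_le
  obtain ⟨G, n, hGm, hG, hGF⟩ := exists_dependsOn_eLpNorm_sub_lt hF hFm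
    (ENNReal.half_pos (ENNReal.coe_ne_zero.mpr hε.ne'))
  obtain ⟨σ, hσ, hστ, hH⟩ := h (n + 1)
  have hGFm : AEStronglyMeasurable (G - F) μ := (hGm.sub hFm).aestronglyMeasurable
  have hsplit : (fun x ↦ F (x ∘ τ)) - H =ᵐ[μ]
      (G - F) ∘ (fun x ↦ x ∘ σ) - (G - F) ∘ (fun x ↦ x ∘ τ) := by
    filter_upwards [hH] with x hx
    have : G (x ∘ σ) = G (x ∘ τ) := hG fun k hk ↦ by
      simp [hστ k (Nat.lt_succ_of_le hk)]
    simp [this, ← hx]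
  calc eLpNorm ((fun x ↦ F (x ∘ τ)) - H) 1 μ
      = eLpNorm ((G - F) ∘ (fun x ↦ x ∘ σ) - (G - F) ∘ (fun x ↦ x ∘ τ)) 1 μ :=
        eLpNorm_congr_ae hsplit
    _ ≤ eLpNorm ((G - F) ∘ (fun x ↦ x ∘ σ)) 1 μ + eLpNorm ((G - F) ∘ (fun x ↦ x ∘ τ)) 1 μ :=
        eLpNorm_sub_le (hGFm.comp_measurePreserving hσ) (hGFm.comp_measurePreserving hτ) le_rfl
    _ ≤ ε / 2 + ε / 2 := by
        rw [eLpNorm_comp_measurePreserving hGFm hσ, eLpNorm_comp_measurePreserving hGFm hτ]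
        exact add_le_add hGF.le hGF.le
    _ = 0 + ε := by rw [ENNReal.add_halves, zero_add]

/-- Finite kernels into a countably generated space are almost everywhere equal as soon as they
almost everywhere agree on each measurable set. -/
lemma ProbabilityTheory.Kernel.ae_eq_of_forall_measurableSet {α β : Type*} [MeasurableSpace α]
    [MeasurableSpace β] [MeasurableSpace.CountableOrCountablyGenerated α β] {μ : Measure α}
    [IsFiniteMeasure μ] {κ η : Kernel α β} [IsFiniteKernel κ] [IsFiniteKernel η]
    (h : ∀ t, MeasurableSet t → ∀ᵐ a ∂μ, κ a t = η a t) : ∀ᵐ a ∂μ, κ a = η a := by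
  refine Kernel.ae_eq_of_compProd_eq (Measure.ext_prod fun {s t} hs ht ↦ ?_)
  rw [Measure.compProd_apply_prod hs ht, Measure.compProd_apply_prod hs ht]
  exact lintegral_congr_ae (ae_restrict_of_ae (h t ht))

/-- Finite kernels into a countable product are almost everywhere equal as soon as they
almost everywhere agree on each measurable cylinder. -/
lemma ProbabilityTheory.Kernel.ae_eq_of_forall_cylinder {α ι Y : Type*} [Countable ι]
    [MeasurableSpace α] [MeasurableSpace Y] [StandardBorelSpace Y] {μ : Measure α}
    [IsFiniteMeasure μ] {κ η : Kernel α (ι → Y)} [IsFiniteKernel κ] [IsFiniteKernel η]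
    (h : ∀ (I : Finset ι) (t : Set (I → Y)), MeasurableSet t →
      ∀ᵐ a ∂μ, κ a (cylinder I t) = η a (cylinder I t)) :
    ∀ᵐ a ∂μ, κ a = η a := by
  have hI (I : Finset ι) : ∀ᵐ a ∂μ, κ.map I.restrict a = η.map I.restrict a := by
    refine Kernel.ae_eq_of_forall_measurableSet fun t ht ↦ ?_
    filter_upwards [h I t ht] with a ha
    rwa [Kernel.map_apply' _ (Finset.measurable_restrict I) _ ht,
      Kernel.map_apply' _ (Finset.measurable_restrict I) _ ht]
  filter_upwards [ae_all_iff.mpr hI] with a ha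
  refine IsProjectiveLimit.unique (P := fun I ↦ (η a).map I.restrict) (fun I ↦ ?_) fun I ↦ rfl
  rw [← Kernel.map_apply _ (Finset.measurable_restrict I), ha I,
    Kernel.map_apply _ (Finset.measurable_restrict I)]

/-- **Permutation covariance implies shift covariance**: let `p : A → (ℕ → X)` be an
exchangeable Markov kernel and `f : (ℕ → X) → (ℕ → Y)` a Markov kernel (all spaces
standard Borel) such that for every finite permutation `σ` and every `a`, for `p a`-almost
every `x`, `f (x ∘ σ)` is the pushforward of `f x` under `y ↦ y ∘ σ`.  Then for every `a`,
for `p a`-almost every `x`, `f (x ∘ succ)` is the pushforward of `f x` under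
`y ↦ y ∘ succ`. -/
theorem perm_covariance_implies_shift_covariance
    {A X Y : Type*} [MeasurableSpace A] [MeasurableSpace X] [MeasurableSpace Y]
    [StandardBorelSpace A] [StandardBorelSpace X] [StandardBorelSpace Y]
    (p : Kernel A (ℕ → X)) [IsMarkovKernel p] (hp : ExchangeableKernel p)
    (f : Kernel (ℕ → X) (ℕ → Y)) [IsMarkovKernel f]
    (hf : ∀ σ : Equiv.Perm ℕ, {n | σ n ≠ n}.Finite →
      ∀ a, ∀ᵐ x ∂(p a), f (x ∘ σ) = (f x).map (fun y => y ∘ σ)) :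
    ∀ a, ∀ᵐ x ∂(p a),
      f (fun k => x (k + 1)) = (f x).map (fun y (k : ℕ) => y (k + 1)) := by
  intro a
  have hX : Measurable fun (x : ℕ → X) (k : ℕ) ↦ x (k + 1) := measurable_comp_reindex Nat.succ
  have hY : Measurable fun (y : ℕ → Y) (k : ℕ) ↦ y (k + 1) := measurable_comp_reindex Nat.succ
  have key : ∀ᵐ x ∂(p a),
      f.comap (fun (x : ℕ → X) (k : ℕ) ↦ x (k + 1)) hX x
        = f.map (fun (y : ℕ → Y) (k : ℕ) ↦ y (k + 1)) x := by
    have := Kernel.IsMarkovKernel.map f hY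
    refine Kernel.ae_eq_of_forall_cylinder fun I t ht ↦ ?_
    have hC : MeasurableSet (cylinder (α := fun _ : ℕ ↦ Y) I t) := ht.cylinder I
    have hFm : Measurable fun x ↦ (f x).real (cylinder (α := fun _ : ℕ ↦ Y) I t) :=
      (Kernel.measurable_coe f hC).ennreal_toReal
    have hF : Integrable (fun x ↦ (f x).real (cylinder (α := fun _ : ℕ ↦ Y) I t)) (p a) :=
      .of_bound hFm.aestronglyMeasurable 1 <| .of_forall fun x ↦ by
        rw [Real.norm_of_nonneg measureReal_nonneg]
        exact measureReal_le_one
    obtain ⟨m, hm⟩ := I.exists_nat_subset_range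
    have hae := ae_eq_comp_reindex (τ := Nat.succ)
      (H := fun x ↦ (f x).real ((fun y k ↦ y (k + 1)) ⁻¹' cylinder (α := fun _ : ℕ ↦ Y) I t))
      hF hFm fun n ↦ by
        obtain ⟨σ, hσ, hσs⟩ := exists_finite_perm_eq_succ (max n m)
        refine ⟨σ, ⟨measurable_comp_reindex σ, hp σ hσ a⟩, fun k hk ↦ hσs k (by omega), ?_⟩
        filter_upwards [hf σ hσ a] with x hx
        rw [hx, map_measureReal_apply (measurable_comp_reindex σ) hC]
        congr 1
        ext y
        rw [Set.mem_preimage, Set.mem_preimage, mem_cylinder, mem_cylinder,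
          Finset.restrict_comp_reindex_congr (τ := Nat.succ)
            (fun k hk ↦ (Finset.mem_range.mp (hm hk)).trans_le (le_max_right n m)) hσs y]
        rfl
    filter_upwards [hae] with x hx
    rw [Kernel.comap_apply, Kernel.map_apply' _ hY _ hC]
    exact (measureReal_eq_measureReal_iff).mp hx
  filter_upwards [key] with x hx
  rwa [Kernel.comap_apply, Kernel.map_apply _ hY] at hx
end

section
/- Single entry independence I: let X be a standard Borel space, let p be a row-column exchangeable probability measure on ℕ × ℕ → X, and fix n ∈ ℕ with 𝒜 = {0,…,n−1}. Then under p, the family of σ-algebras (ℱ_{{(i,j)}})_{(i,j) ∈ 𝒜 × 𝒜} generated by the individual coordinates with both indices in 𝒜 is mutually conditionally independent given the σ-algebra ℱ_{(𝒜 × 𝒜ᶜ) ∪ (𝒜ᶜ × 𝒜) ∪ (𝒜ᶜ × 𝒜ᶜ)} generated by all coordinates outside 𝒜 × 𝒜. -/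
open MeasureTheory ProbabilityTheory

/-- A measure on `ℕ × ℕ → X` is row-column exchangeable if for every permutation `σ` of `ℕ`
fixing all but finitely many elements, it is invariant under permuting the rows by `σ` and
under permuting the columns by `σ`. -/
def RowColumnExchangeable {X : Type*} [MeasurableSpace X]
    (p : Measure (ℕ × ℕ → X)) : Prop :=
  ∀ σ : Equiv.Perm ℕ, {n | σ n ≠ n}.Finite →
    p.map (fun x (ij : ℕ × ℕ) => x (σ ij.1, ij.2)) = p ∧
    p.map (fun x (ij : ℕ × ℕ) => x (ij.1, σ ij.2)) = p

/-- The sub-σ-algebra `ℱ_S` of `ℕ × ℕ → X` generated by the coordinate projections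
`x ↦ x (i, j)` for `(i, j) ∈ S`. -/
def coordSigma (X : Type*) [mX : MeasurableSpace X] (S : Set (ℕ × ℕ)) :
    MeasurableSpace (ℕ × ℕ → X) :=
  ⨆ ij ∈ S, mX.comap (fun x => x ij)

lemma coordSigma_le (X : Type*) [MeasurableSpace X] (S : Set (ℕ × ℕ)) :
    coordSigma X S ≤ MeasurableSpace.pi :=
  iSup₂_le fun ij _ => (measurable_pi_apply ij).comap_le

/-- The set `𝒜 = {0, …, n-1} ⊆ ℕ`. -/
def blk (n : ℕ) : Set ℕ := {k | k < n}

/-- Conditional expectations are transported by measure preserving maps. -/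
lemma condExp_comp_measurePreserving {Ω : Type*} {m m₀ : MeasurableSpace Ω} {μ : Measure Ω}
    [IsFiniteMeasure μ] (hm : m ≤ m₀) {T : Ω → Ω} (hT : MeasurePreserving T μ μ) {f : Ω → ℝ}
    (hf : Integrable f μ) :
    μ[f | m] ∘ T =ᵐ[μ] μ[f ∘ T | m.comap T] := by
  have hcomap : m.comap T ≤ m₀ :=
    (MeasurableSpace.comap_mono hm).trans hT.measurable.comap_le
  have hfm : AEStronglyMeasurable f (μ.map T) := by rw [hT.map_eq]; exact hf.1
  have hgm : AEStronglyMeasurable (μ[f | m]) (μ.map T) := by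
    rw [hT.map_eq]; exact integrable_condExp.1
  refine ae_eq_condExp_of_forall_setIntegral_eq hcomap (hT.integrable_comp_of_integrable hf)
    (fun s _ _ => (hT.integrable_comp_of_integrable integrable_condExp).integrableOn) ?_
    (stronglyMeasurable_condExp.comp_measurable (comap_measurable T)).aestronglyMeasurable
  rintro _ ⟨t, ht, rfl⟩ -
  have h₁ := setIntegral_map (hm t ht) hgm hT.measurable.aemeasurable
  have h₂ := setIntegral_map (hm t ht) hfm hT.measurable.aemeasurable
  rw [hT.map_eq] at h₁ h₂
  simp only [Function.comp_apply]
  rw [← h₁, ← h₂, setIntegral_condExp hm hf ht]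

/-- Two nested conditional expectations of a square integrable function which have the same second
moment agree almost everywhere. -/
lemma condExp_ae_eq_of_integral_sq_eq {Ω : Type*} {m₁ m₂ m₀ : MeasurableSpace Ω} {μ : Measure Ω}
    [IsFiniteMeasure μ] (h₁₂ : m₁ ≤ m₂) (h₂ : m₂ ≤ m₀) {f : Ω → ℝ} (hf : MemLp f 2 μ)
    (hsq : ∫ x, (μ[f | m₁]) x ^ 2 ∂μ = ∫ x, (μ[f | m₂]) x ^ 2 ∂μ) :
    μ[f | m₁] =ᵐ[μ] μ[f | m₂] := by
  have hL₁ : MemLp (μ[f | m₁]) 2 μ := hf.condExp one_le_two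
  have hL₂ : MemLp (μ[f | m₂]) 2 μ := hf.condExp one_le_two
  have hmul : Integrable (μ[f | m₁] * μ[f | m₂]) μ := hL₁.integrable_mul hL₂
  have hcross : ∫ x, (μ[f | m₁]) x * (μ[f | m₂]) x ∂μ = ∫ x, (μ[f | m₁]) x ^ 2 ∂μ := by
    have hpull : μ[μ[f | m₁] * μ[f | m₂] | m₁] =ᵐ[μ] μ[f | m₁] * μ[f | m₁] :=
      (condExp_mul_of_stronglyMeasurable_left stronglyMeasurable_condExp hmul
        integrable_condExp).trans ((condExp_condExp_of_le (f := f) h₁₂ h₂).mono fun x hx => by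
          simp only [Pi.mul_apply, hx])
    calc ∫ x, (μ[f | m₁]) x * (μ[f | m₂]) x ∂μ
        = ∫ x, (μ[μ[f | m₁] * μ[f | m₂] | m₁]) x ∂μ :=
          (integral_condExp (f := μ[f | m₁] * μ[f | m₂]) (h₁₂.trans h₂)).symm
      _ = ∫ x, (μ[f | m₁]) x ^ 2 ∂μ :=
          integral_congr_ae (hpull.mono fun x hx => by simp only [hx, Pi.mul_apply, sq])
  have hzero : ∫ x, ((μ[f | m₁]) x - (μ[f | m₂]) x) ^ 2 ∂μ = 0 := by
    have hexp : ∀ x, ((μ[f | m₁]) x - (μ[f | m₂]) x) ^ 2 =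
        (μ[f | m₁]) x ^ 2 - 2 * ((μ[f | m₁]) x * (μ[f | m₂]) x) + (μ[f | m₂]) x ^ 2 :=
      fun x => by ring
    simp_rw [hexp]
    have hmul₂ : Integrable (fun x => 2 * ((μ[f | m₁]) x * (μ[f | m₂]) x)) μ := hmul.const_mul 2
    rw [integral_add (f := fun x => (μ[f | m₁]) x ^ 2 - 2 * ((μ[f | m₁]) x * (μ[f | m₂]) x))
      (hL₁.integrable_sq.sub hmul₂) hL₂.integrable_sq,
      integral_sub hL₁.integrable_sq hmul₂, integral_const_mul, hcross, ← hsq]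
    ring
  have hae := (integral_eq_zero_iff_of_nonneg (fun x => sq_nonneg _)
    (hL₁.sub hL₂).integrable_sq).1 hzero
  filter_upwards [hae] with x hx
  exact sub_eq_zero.1 (pow_eq_zero_iff two_ne_zero |>.1 hx)

/-- If a measure preserving map `T` fixes `f` and pulls `m₂` back into `m₁ ≤ m₂`, then conditioning
`f` on `m₂` is the same as conditioning it on `m₁`. -/
lemma condExp_ae_eq_of_measurePreserving {Ω : Type*} {m₁ m₂ m₀ : MeasurableSpace Ω}
    {μ : Measure Ω} [IsFiniteMeasure μ] (h₁₂ : m₁ ≤ m₂) (h₂ : m₂ ≤ m₀) {T : Ω → Ω}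
    (hT : MeasurePreserving T μ μ) (hcomap : m₂.comap T ≤ m₁) {f : Ω → ℝ} (hf : MemLp f 2 μ)
    (hfT : f ∘ T = f) :
    μ[f | m₂] =ᵐ[μ] μ[f | m₁] := by
  have hintegrable : Integrable f μ := hf.integrable one_le_two
  have htrans : μ[f | m₂] ∘ T =ᵐ[μ] μ[f | m₂.comap T] := by
    simpa only [hfT] using condExp_comp_measurePreserving h₂ hT hintegrable
  have hsq : ∫ x, (μ[f | m₂.comap T]) x ^ 2 ∂μ = ∫ x, (μ[f | m₂]) x ^ 2 ∂μ := by
    have hmeas : AEStronglyMeasurable (fun x => (μ[f | m₂]) x ^ 2) (μ.map T) := by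
      rw [hT.map_eq]; exact integrable_condExp.1.pow 2
    have hmap := integral_map hT.measurable.aemeasurable hmeas
    rw [hT.map_eq] at hmap
    rw [hmap]
    exact integral_congr_ae (htrans.mono fun x hx => by simp only [← hx, Function.comp_apply])
  have heq : μ[f | m₂.comap T] =ᵐ[μ] μ[f | m₂] :=
    condExp_ae_eq_of_integral_sq_eq (hcomap.trans h₁₂) h₂ hf hsq
  have hm₁ : AEStronglyMeasurable[m₁] (μ[f | m₂]) μ :=
    ⟨μ[f | m₂.comap T], stronglyMeasurable_condExp.mono hcomap, heq.symm⟩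
  exact (condExp_of_aestronglyMeasurable' (h₁₂.trans h₂) hm₁ integrable_condExp).symm.trans
    (condExp_condExp_of_le h₁₂ h₂)

/-- A family of σ-algebras is conditionally independent given `m'` as soon as, for every index `i`,
conditioning an event of `m i` on some σ-algebra containing `m'` and all the other `m j` is the same
as conditioning it on `m'`. -/
lemma iCondIndep_of_condExp_ae_eq {Ω ι : Type*} {m' m₀ : MeasurableSpace Ω}
    [StandardBorelSpace Ω] {μ : Measure Ω} [IsFiniteMeasure μ] (hm' : m' ≤ m₀)
    {m M : ι → MeasurableSpace Ω} (hm : ∀ i, m i ≤ m₀) (hM : ∀ i, M i ≤ m₀)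
    (hm'M : ∀ i, m' ≤ M i) (hmM : ∀ i j, j ≠ i → m j ≤ M i)
    (h : ∀ i s, MeasurableSet[m i] s → μ⟦s | M i⟧ =ᵐ[μ] μ⟦s | m'⟧) :
    iCondIndep m' hm' m μ := by
  classical
  rw [iCondIndep_iff m' hm' m hm μ]
  intro s f hs
  induction s using Finset.induction_on with
  | empty =>
    simp only [Finset.notMem_empty, Set.iInter_of_empty, Set.iInter_univ, Set.indicator_univ,
      Finset.prod_empty]
    rw [condExp_const hm' (1 : ℝ)]
    exact Filter.EventuallyEq.rfl
  | insert i s hi ih =>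
    specialize ih fun j hj => hs j (Finset.mem_insert_of_mem hj)
    set B : Set Ω := ⋂ j ∈ s, f j
    have hfi : MeasurableSet[m i] (f i) := hs i (Finset.mem_insert_self i s)
    have hBM : MeasurableSet[M i] B :=
      Finset.measurableSet_biInter s fun j hj =>
        hmM i j (fun hji => hi (hji ▸ hj)) _ (hs j (Finset.mem_insert_of_mem hj))
    have hfi₀ : MeasurableSet (f i) := hm i _ hfi
    have hB₀ : MeasurableSet B := hM i _ hBM
    have hintegrable : ∀ {t : Set Ω}, MeasurableSet t → Integrable (t.indicator fun _ => (1 : ℝ)) μ :=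
      fun ht => (integrable_const 1).indicator ht
    have hinter : (⋂ j ∈ insert i s, f j) = B ∩ f i := by
      rw [Finset.set_biInter_insert, Set.inter_comm]
    have hind : ((B ∩ f i).indicator fun _ => (1 : ℝ)) =
        (B.indicator fun _ => (1 : ℝ)) * (f i).indicator fun _ => (1 : ℝ) := by
      ext x
      rw [Pi.mul_apply, ← Set.inter_indicator_mul, mul_one]
    have hbd : ∀ᵐ x ∂μ, ‖(μ⟦f i | m'⟧) x‖ ≤ (1 : ℝ) := by
      refine ae_bdd_abs_condExp_of_ae_bdd_abs (R := 1) (Filter.Eventually.of_forall fun x => ?_)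
      by_cases hx : x ∈ f i <;> simp [hx]
    have hpull : μ⟦B ∩ f i | M i⟧ =ᵐ[μ] (B.indicator fun _ => (1 : ℝ)) * μ⟦f i | m'⟧ := by
      rw [hind]
      refine (condExp_mul_of_stronglyMeasurable_left
        (stronglyMeasurable_const.indicator hBM) ?_ (hintegrable hfi₀)).trans ?_
      · rw [← hind]
        exact hintegrable (hB₀.inter hfi₀)
      · exact (h i _ hfi).mono fun x hx => by simp only [Pi.mul_apply, hx]
    rw [hinter, Finset.prod_insert hi]
    calc μ⟦B ∩ f i | m'⟧
        =ᵐ[μ] μ[μ⟦B ∩ f i | M i⟧ | m'] := (condExp_condExp_of_le (hm'M i) (hM i)).symm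
      _ =ᵐ[μ] μ[(B.indicator fun _ => (1 : ℝ)) * μ⟦f i | m'⟧ | m'] := condExp_congr_ae hpull
      _ =ᵐ[μ] μ[μ⟦f i | m'⟧ * (B.indicator fun _ => (1 : ℝ)) | m'] := by rw [mul_comm]
      _ =ᵐ[μ] μ⟦f i | m'⟧ * μ⟦B | m'⟧ :=
        condExp_stronglyMeasurable_mul_of_bound hm' stronglyMeasurable_condExp (hintegrable hB₀) 1 hbd
      _ =ᵐ[μ] μ⟦f i | m'⟧ * ∏ j ∈ s, μ⟦f j | m'⟧ :=
        ih.mono fun x hx => by simp only [Pi.mul_apply, hx]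

/-- An injective self-map agrees on any finite set with a permutation of finite support. -/
lemma exists_perm_finite_support_eqOn {α : Type*} {φ : α → α}
    (hφ : Function.Injective φ) (s : Finset α) :
    ∃ σ : Equiv.Perm α, {a | σ a ≠ a}.Finite ∧ ∀ a ∈ s, σ a = φ a := by
  classical
  have hmaps : Set.MapsTo (fun a : ↥(s ∪ s.image φ) => φ a) {a | (a : α) ∈ s}
      (s ∪ s.image φ : Finset α) := fun a ha =>
    Finset.mem_coe.2 (Finset.mem_union_right _ (Finset.mem_image_of_mem _ ha))
  obtain ⟨g, hg⟩ := hmaps.exists_equiv_extend_of_card_eq (Fintype.card_coe _)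
    (hφ.comp Subtype.val_injective).injOn
  refine ⟨Equiv.Perm.ofSubtype g, (s ∪ s.image φ).finite_toSet.subset fun a ha => ?_,
    fun a ha => ?_⟩
  · by_contra hmem
    exact ha (Equiv.Perm.ofSubtype_apply_of_not_mem g hmem)
  · have hmem : a ∈ s ∪ s.image φ := Finset.mem_union_left _ ha
    rw [Equiv.Perm.ofSubtype_apply_of_mem g hmem]
    exact hg ⟨a, hmem⟩ ha

/-- A row-column exchangeable measure is invariant under all pairs of injective maps of rows and
columns. -/
lemma RowColumnExchangeable.measurePreserving {X : Type*} [MeasurableSpace X]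
    {p : Measure (ℕ × ℕ → X)} [IsFiniteMeasure p] (hp : RowColumnExchangeable p)
    {φ ψ : ℕ → ℕ} (hφ : Function.Injective φ) (hψ : Function.Injective ψ) :
    MeasurePreserving (fun (x : ℕ × ℕ → X) (ij : ℕ × ℕ) => x (φ ij.1, ψ ij.2)) p p := by
  have hmeas : ∀ φ ψ : ℕ → ℕ,
      Measurable (fun (x : ℕ × ℕ → X) (ij : ℕ × ℕ) => x (φ ij.1, ψ ij.2)) :=
    fun φ ψ => measurable_pi_lambda _ fun ij => measurable_pi_apply _
  refine ⟨hmeas φ ψ, ?_⟩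
  refine IsProjectiveLimit.unique (P := fun I : Finset (ℕ × ℕ) => p.map I.restrict)
    (fun I => ?_) (fun I => rfl)
  obtain ⟨σ, hσ, hσI⟩ := exists_perm_finite_support_eqOn hφ (I.image Prod.fst)
  obtain ⟨τ, hτ, hτI⟩ := exists_perm_finite_support_eqOn hψ (I.image Prod.snd)
  have hστ : p.map (fun (x : ℕ × ℕ → X) (ij : ℕ × ℕ) => x (σ ij.1, τ ij.2)) = p := by
    have hcomp := Measure.map_map (μ := p) (hmeas id τ) (hmeas σ id)
    simp only [id] at hcomp
    rw [(hp σ hσ).1, (hp τ hτ).2] at hcomp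
    exact hcomp.symm
  have hrestrict : I.restrict ∘ (fun (x : ℕ × ℕ → X) (ij : ℕ × ℕ) => x (φ ij.1, ψ ij.2)) =
      I.restrict ∘ (fun (x : ℕ × ℕ → X) (ij : ℕ × ℕ) => x (σ ij.1, τ ij.2)) := by
    funext x ij
    simp only [Function.comp_apply, Finset.restrict_def]
    rw [hσI _ (Finset.mem_image_of_mem _ ij.2), hτI _ (Finset.mem_image_of_mem _ ij.2)]
  rw [Measure.map_map (Finset.measurable_restrict I) (hmeas φ ψ), hrestrict,
    ← Measure.map_map (Finset.measurable_restrict I) (hmeas σ τ), hστ]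

lemma coordSigma_mono (X : Type*) [MeasurableSpace X] {S T : Set (ℕ × ℕ)} (h : S ⊆ T) :
    coordSigma X S ≤ coordSigma X T :=
  biSup_mono fun _ hij => h hij

lemma coordSigma_singleton (X : Type*) [mX : MeasurableSpace X] (ij : ℕ × ℕ) :
    coordSigma X {ij} = mX.comap (fun x => x ij) :=
  iSup_singleton

/-- Pulling back coordinates along a reindexing of the array. -/
lemma comap_coordSigma_le {X : Type*} [MeasurableSpace X] {S T : Set (ℕ × ℕ)}
    {θ : ℕ × ℕ → ℕ × ℕ} (h : Set.MapsTo θ S T) :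
    (coordSigma X S).comap (fun (x : ℕ × ℕ → X) ij => x (θ ij)) ≤ coordSigma X T := by
  simp only [coordSigma, MeasurableSpace.comap_iSup, MeasurableSpace.comap_comp]
  refine iSup₂_le fun ij hij => ?_
  exact le_iSup₂_of_le (θ ij) (h hij) le_rfl

/-- Shifting every natural number except `i < n` by `n` is injective. -/
lemma injective_ite_shift {i n : ℕ} (hi : i < n) :
    Function.Injective (fun k => if k = i then i else k + n) := by
  intro a b hab
  dsimp only at hab
  split_ifs at hab <;> omega


/-- **Single entry independence I**: let `p` be a row-column exchangeable probability
measure on `ℕ × ℕ → X` (`X` standard Borel) and `𝒜 = {0,…,n-1}`.  Then under `p` the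
σ-algebras generated by the individual coordinates `(i, j)` with `i, j ∈ 𝒜` are mutually
conditionally independent given the σ-algebra generated by all coordinates outside
`𝒜 × 𝒜`, i.e. those in `(𝒜 × 𝒜ᶜ) ∪ (𝒜ᶜ × 𝒜) ∪ (𝒜ᶜ × 𝒜ᶜ)`. -/
theorem single_entry_independence_I
    {X : Type*} [MeasurableSpace X] [StandardBorelSpace X]
    (p : Measure (ℕ × ℕ → X)) [IsProbabilityMeasure p]
    (hp : RowColumnExchangeable p) (n : ℕ) :
    iCondIndep
      (coordSigma X ((blk n ×ˢ (blk n)ᶜ) ∪ ((blk n)ᶜ ×ˢ blk n) ∪ ((blk n)ᶜ ×ˢ (blk n)ᶜ)))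
      (coordSigma_le X _)
      (fun ij : Fin n × Fin n => coordSigma X {((ij.1 : ℕ), (ij.2 : ℕ))}) p := by
  have hG : ∀ ij : Fin n × Fin n,
      ((blk n ×ˢ (blk n)ᶜ) ∪ ((blk n)ᶜ ×ˢ blk n) ∪ ((blk n)ᶜ ×ˢ (blk n)ᶜ) : Set (ℕ × ℕ)) ⊆
        {((ij.1 : ℕ), (ij.2 : ℕ))}ᶜ := by
    rintro ⟨i, j⟩ ⟨a, b⟩ hab heq
    obtain ⟨rfl, rfl⟩ := Prod.mk.inj heq
    simp [blk] at hab
  refine iCondIndep_of_condExp_ae_eq (coordSigma_le X _)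
    (M := fun ij : Fin n × Fin n => coordSigma X {((ij.1 : ℕ), (ij.2 : ℕ))}ᶜ)
    (fun _ => coordSigma_le X _) (fun _ => coordSigma_le X _)
    (fun ij => coordSigma_mono X (hG ij)) (fun ij kl hne => coordSigma_mono X ?_) ?_
  · rintro _ rfl heq
    exact hne (Prod.ext (Fin.ext (congrArg Prod.fst heq)) (Fin.ext (congrArg Prod.snd heq)))
  · rintro ⟨i, j⟩ s hs
    have hT := hp.measurePreserving (injective_ite_shift i.2) (injective_ite_shift j.2)
    refine condExp_ae_eq_of_measurePreserving (coordSigma_mono X (hG (i, j))) (coordSigma_le X _)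
      hT (comap_coordSigma_le ?_)
      ((memLp_const 1).indicator (coordSigma_le X _ _ hs)) ?_
    · rintro ⟨a, b⟩ hab
      simp only [Set.mem_compl_iff, Set.mem_singleton_iff, Prod.mk.injEq] at hab
      simp only [blk, Set.mem_union, Set.mem_prod, Set.mem_compl_iff, Set.mem_ofPred_eq]
      split_ifs <;> omega
    · rw [coordSigma_singleton] at hs
      obtain ⟨t, -, rfl⟩ := hs
      funext x
      classical
      rw [Function.comp_apply, Set.indicator_apply, Set.indicator_apply]
      refine if_congr ?_ rfl rfl
      simp only [Set.mem_preimage, if_true]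
end
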